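/- arXiv:2603.03943 — 11 statements merged into one kernel-verified Lean document; each statement's English description precedes it below -/
import Mathlib

section
/- Let m ∈ ℕ, let f : ℝ → ℝ be analytic on all of ℝ and not identically zero, and let g, g̃ : (Fin m → ℝ) → ℝ be analytic on their whole domain, not identically zero, and satisfy g 0 = 0 and g̃ 0 = 0. If f (x + g y) = f (x + g̃ y) for every x ∈ ℝ and every y : Fin m → ℝ, then either g = g̃ or f is a constant function. -/
theorem stmt_0 (m : ℕ) (f : ℝ → ℝ) (g g_t : (Fin m → ℝ) → ℝ)
    (hf : AnalyticOn ℝ f Set.univ) (hfne : f ≠ 0)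
    (hg : AnalyticOn ℝ g Set.univ) (hgt : AnalyticOn ℝ g_t Set.univ)
    (hgne : g ≠ 0) (hgtne : g_t ≠ 0)
    (hg0 : g 0 = 0) (hgt0 : g_t 0 = 0)
    (h : ∀ (x : ℝ) (y : Fin m → ℝ), f (x + g y) = f (x + g_t y)) :
    g = g_t ∨ ∃ c : ℝ, f = fun _ => c := by
  by_cases hgg : g = g_t
  · exact Or.inl hgg
  right
  obtain ⟨y₀, hy₀⟩ := Function.ne_iff.mp hgg
  have hgc : Continuous g := continuousOn_univ.mp hg.continuousOn
  have hgtc : Continuous g_t := continuousOn_univ.mp hgt.continuousOn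
  have hper : ∀ y, Function.Periodic f (g y - g_t y) := by
    intro y x
    have := h (x - g_t y) y
    rw [sub_add_cancel] at this
    rw [← this]
    congr 1
    ring
  have ha : g y₀ - g_t y₀ ≠ 0 := sub_ne_zero.mpr hy₀
  -- every multiple of the difference by a ratio in the unit interval is a period
  have hsmall : ∀ r : ℝ, 0 ≤ r → r ≤ 1 → Function.Periodic f (r * (g y₀ - g_t y₀)) := by
    intro r hr0 hr1
    have hconn : IsPreconnected (Set.range fun y => g y - g_t y) :=
      isPreconnected_range (hgc.sub hgtc)
    have hord := hconn.ordConnected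
    have h0 : (0 : ℝ) ∈ Set.range fun y => g y - g_t y := ⟨0, by simp [hg0, hgt0]⟩
    have h1 : g y₀ - g_t y₀ ∈ Set.range fun y => g y - g_t y := ⟨y₀, rfl⟩
    have hmem : r * (g y₀ - g_t y₀) ∈ Set.uIcc 0 (g y₀ - g_t y₀) := by
      rw [Set.mem_uIcc]
      rcases le_total 0 (g y₀ - g_t y₀) with hs | hs
      · left; constructor <;> nlinarith
      · right; constructor <;> nlinarith
    obtain ⟨y, hy⟩ := hord.uIcc_subset h0 h1 hmem
    have := hper y
    simp only at hy
    rwa [hy] at this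
  have hpos : ∀ s : ℝ, 0 ≤ s → Function.Periodic f (s * (g y₀ - g_t y₀)) := by
    intro s hs
    obtain ⟨n, hn⟩ := exists_nat_gt s
    have hn0 : (0 : ℝ) < n := lt_of_le_of_lt hs hn
    have := (hsmall (s / n) (by positivity) ((div_le_one hn0).mpr hn.le)).nat_mul n
    have e : (n : ℝ) * (s / n * (g y₀ - g_t y₀)) = s * (g y₀ - g_t y₀) := by
      field_simp
    rwa [e] at this
  refine ⟨f 0, funext fun t => ?_⟩
  rcases le_total 0 (t / (g y₀ - g_t y₀)) with hs | hs
  · have := hpos _ hs 0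
    rwa [div_mul_cancel₀ _ ha, zero_add] at this
  · have := hpos (-(t / (g y₀ - g_t y₀))) (by linarith) t
    rw [neg_mul, div_mul_cancel₀ _ ha, add_neg_cancel] at this
    exact this.symm
end

section
/- Consider the network model on a DAG with n nodes in which every edge function f i j is continuous. Then for every constant input vector u : Fin n → ℝ and every initial condition vector c : Fin n → ℝ there exists a unique trajectory for (f, u, c), i.e., a unique family x : Fin n → ℝ → ℝ of continuous functions satisfying x j t = (∫ τ in 0..t, ∑ ℓ, f j ℓ (x ℓ τ)) + u j * t + c j for all j and all t ∈ ℝ. -/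
/-- A trajectory of the continuous-time network model on a DAG with `n` nodes:
a family of continuous functions satisfying the integral form of the dynamics. -/
def IsTrajectory (n : ℕ) (f : Fin n → Fin n → ℝ → ℝ) (u c : Fin n → ℝ)
    (x : Fin n → ℝ → ℝ) : Prop :=
  (∀ j, Continuous (x j)) ∧
  ∀ (j : Fin n) (t : ℝ),
    x j t = (∫ τ in (0:ℝ)..t, ∑ ℓ, f j ℓ (x ℓ τ)) + u j * t + c j

theorem picard_congr (n : ℕ) (f : Fin n → Fin n → ℝ → ℝ)
    (hdag : ∀ i j, ¬ j < i → f i j = 0) (x y : Fin n → ℝ → ℝ) (j : Fin n)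
    (h : ∀ l, l < j → x l = y l) (τ : ℝ) :
    ∑ l, f j l (x l τ) = ∑ l, f j l (y l τ) := by
  refine Finset.sum_congr rfl fun l _ => ?_
  by_cases hl : l < j
  · rw [h l hl]
  · simp [hdag j l hl]

theorem stmt_3 (n : ℕ) (f : Fin n → Fin n → ℝ → ℝ)
    (hdag : ∀ i j, ¬ j < i → f i j = 0)
    (hcont : ∀ i j, Continuous (f i j))
    (u c : Fin n → ℝ) :
    ∃! x : Fin n → ℝ → ℝ, IsTrajectory n f u c x := by
  let T : (Fin n → ℝ → ℝ) → (Fin n → ℝ → ℝ) := fun x j t =>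
    (∫ τ in (0:ℝ)..t, ∑ l, f j l (x l τ)) + u j * t + c j
  have hT : ∀ x y j, (∀ l, l < j → x l = y l) → T x j = T y j := by
    intro x y j h
    funext t
    simp only [T, picard_congr n f hdag x y j h]
  have hTc : ∀ x, (∀ j, Continuous (x j)) → ∀ j, Continuous (T x j) := by
    intro x hx j
    have h1 : Continuous fun τ => ∑ l, f j l (x l τ) :=
      continuous_finsetSum _ fun l _ => (hcont j l).comp (hx l)
    have h2 : Continuous fun t => ∫ τ in (0:ℝ)..t, ∑ l, f j l (x l τ) :=
      intervalIntegral.continuous_primitive (fun a b => h1.intervalIntegrable a b) 0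
    exact (h2.add (continuous_const.mul continuous_id)).add continuous_const
  have hc : ∀ k j, Continuous (T^[k] (fun _ _ => 0) j) := by
    intro k
    induction k with
    | zero => intro j; exact continuous_const
    | succ k ih =>
      rw [Function.iterate_succ_apply']
      exact hTc _ ih
  have hs : ∀ k (j : Fin n), j.val < k →
      T^[k+1] (fun _ _ => 0) j = T^[k] (fun _ _ => 0) j := by
    intro k
    induction k with
    | zero => intro j hj; omega
    | succ k ih =>
      intro j hj
      rw [Function.iterate_succ_apply' T (k+1)]
      conv_rhs => rw [Function.iterate_succ_apply' T k]
      refine hT _ _ j fun l hl => ih l ?_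
      have : l.val < j.val := hl
      omega
  refine ⟨T^[n] (fun _ _ => 0), ⟨hc n, fun j t => ?_⟩, ?_⟩
  · have := hs n j j.isLt
    rw [Function.iterate_succ_apply'] at this
    exact (congrFun this t).symm
  · rintro y ⟨-, hy⟩
    have hy' : ∀ j, y j = T y j := fun j => funext fun t => hy j t
    have key : ∀ k (j : Fin n), j.val < k → y j = T^[k] (fun _ _ => 0) j := by
      intro k
      induction k with
      | zero => intro j hj; omega
      | succ k ih =>
        intro j hj
        rw [hy' j, Function.iterate_succ_apply']
        refine hT _ _ j fun l hl => ih l ?_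
        have : l.val < j.val := hl
        omega
    exact funext fun j => key n j j.isLt
end

section
/- Consider the network model on a DAG with n nodes in which every edge function f i j is analytic on all of ℝ. Then for every constant input vector u : Fin n → ℝ, every initial condition vector c : Fin n → ℝ, and every trajectory x for (f, u, c), each component t ↦ x j t is analytic on all of ℝ. -/
theorem analyticAt_primitive_aux (g : ℝ → ℝ) (hg : Continuous g) (a : ℝ)
    (h : AnalyticAt ℝ g a) : AnalyticAt ℝ (fun t => ∫ τ in (0:ℝ)..t, g τ) a := by
  obtain ⟨p, hp⟩ := h
  rw [hasFPowerSeriesAt_iff] at hp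
  obtain ⟨ε, hε, hball⟩ := Metric.eventually_nhds_iff.1 hp
  let b : ℕ → ℝ := fun n => Nat.casesOn n (∫ τ in (0:ℝ)..a, g τ) (fun m => p.coeff m / (m + 1))
  refine ⟨FormalMultilinearSeries.ofScalars ℝ b, ?_⟩
  rw [hasFPowerSeriesAt_iff]
  refine Metric.eventually_nhds_iff.2 ⟨ε, hε, fun z hz => ?_⟩
  have hz' : |z| < ε := by simpa using hz
  have hsum : Summable (fun n => |z ^ n * p.coeff n|) := by
    have := (hball hz).summable.abs
    simpa using this
  have hle : ∀ s ∈ Set.uIoc 0 z, |s| ≤ |z| := by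
    intro s hs
    have := Set.abs_sub_left_of_mem_uIcc (Set.uIoc_subset_uIcc hs)
    simpa using this
  have key : HasSum (fun n => ∫ s in (0:ℝ)..z, s ^ n * p.coeff n)
      (∫ s in (0:ℝ)..z, g (a + s)) := by
    apply intervalIntegral.hasSum_integral_of_dominated_convergence
      (fun n _ => |z ^ n * p.coeff n|)
    · intro n
      exact (by fun_prop : Continuous fun s : ℝ => s ^ n * p.coeff n).aestronglyMeasurable
    · intro n
      refine Filter.Eventually.of_forall fun s hs => ?_
      rw [Real.norm_eq_abs, abs_mul, abs_mul, abs_pow, abs_pow]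
      have := hle s hs
      gcongr
    · exact Filter.Eventually.of_forall fun s hs => hsum
    · exact intervalIntegrable_const
    · refine Filter.Eventually.of_forall fun s hs => ?_
      have h1 : dist s 0 < ε := by
        simpa using lt_of_le_of_lt (hle s hs) hz'
      simpa using hball h1
  have e1 : (∫ s in (0:ℝ)..z, g (a + s)) = ∫ s in a..(a + z), g s := by
    simp
  have e2 : (∫ s in (0:ℝ)..(a + z), g s) = (∫ s in a..(a + z), g s) + ∫ s in (0:ℝ)..a, g s := by
    rw [add_comm (∫ s in a..(a + z), g s), intervalIntegral.integral_add_adjacent_intervals] <;>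
      exact hg.intervalIntegrable _ _
  rw [e1] at key
  rw [e2]
  have key2 := (hasSum_nat_add_iff (f := fun n => z ^ n • b n) 1
    (g := ∫ s in a..(a + z), g s)).1 (by
      have e3 : (fun n => ∫ s in (0:ℝ)..z, s ^ n * p.coeff n)
          = fun n => z ^ (n + 1) • b (n + 1) := by
        funext n
        rw [intervalIntegral.integral_mul_const, integral_pow]
        simp [b]
        ring
      rw [e3] at key
      exact key)
  simpa [b, FormalMultilinearSeries.coeff_ofScalars] using key2

theorem stmt_4 (n : ℕ) (f : Fin n → Fin n → ℝ → ℝ)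
    (hdag : ∀ i j, ¬ j < i → f i j = 0)
    (hana : ∀ i j, AnalyticOn ℝ (f i j) Set.univ)
    (u c : Fin n → ℝ) (x : Fin n → ℝ → ℝ)
    (hx : IsTrajectory n f u c x) :
    ∀ j, AnalyticOn ℝ (x j) Set.univ := by
  obtain ⟨hc, he⟩ := hx
  have hA : ∀ i j a, AnalyticAt ℝ (f i j) a := fun i j a =>
    (analyticOn_univ.1 (hana i j)) a (Set.mem_univ a)
  have main : ∀ (k : ℕ) (j : Fin n), j.val = k → ∀ a, AnalyticAt ℝ (x j) a := by
    intro k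
    induction k using Nat.strong_induction_on with
    | _ k ih =>
      intro j hj a
      have hf : x j = fun t => (∫ τ in (0:ℝ)..t, ∑ ℓ, f j ℓ (x ℓ τ)) + u j * t + c j :=
        funext (he j)
      rw [hf]
      have h1 : Continuous fun τ => ∑ ℓ, f j ℓ (x ℓ τ) := by
        refine continuous_finsetSum _ fun ℓ _ => ?_
        have : Continuous (f j ℓ) :=
          continuous_iff_continuousAt.2 fun y => (hA j ℓ y).continuousAt
        exact this.comp (hc ℓ)
      have h2 : AnalyticAt ℝ (fun τ => ∑ ℓ, f j ℓ (x ℓ τ)) a := by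
        refine Finset.analyticAt_fun_sum _ fun ℓ _ => ?_
        by_cases hl : ℓ < j
        · exact (hA j ℓ _).comp (ih ℓ.val (hj ▸ hl) ℓ rfl a)
        · rw [hdag j ℓ hl]
          exact analyticAt_const
      exact ((analyticAt_primitive_aux _ h1 a h2).add
        (analyticAt_const.mul analyticAt_id)).add analyticAt_const
  intro j a _
  exact (main j.val j rfl a).analyticWithinAt
end

section
/- Consider two network models on DAGs with n nodes, with continuous edge functions f and f̃, constant inputs u and ũ, initial conditions c and c̃, and trajectories x for (f, u, c) and x̃ for (f̃, ũ, c̃). Fix a node m, and let A ⊆ Fin n be the set of ancestors of m: nodes k such that Relation.ReflTransGen R k m holds, where R ℓ j is defined as (f j ℓ ≠ 0 ∨ f̃ j ℓ ≠ 0). If f k ℓ = f̃ k ℓ for every k ∈ A and every ℓ, and u k = ũ k and c k = c̃ k for every k ∈ A, then x m = x̃ m (the trajectories of node m coincide on all of ℝ). -/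
theorem stmt_5 (n : ℕ) (f f_t : Fin n → Fin n → ℝ → ℝ)
    (hdag : ∀ i j, ¬ j < i → f i j = 0)
    (hdag' : ∀ i j, ¬ j < i → f_t i j = 0)
    (hcont : ∀ i j, Continuous (f i j))
    (hcont' : ∀ i j, Continuous (f_t i j))
    (u u_t c c_t : Fin n → ℝ) (x x_t : Fin n → ℝ → ℝ)
    (hx : IsTrajectory n f u c x) (hx_t : IsTrajectory n f_t u_t c_t x_t)
    (m : Fin n)
    (hf : ∀ k, Relation.ReflTransGen (fun ℓ j => f j ℓ ≠ 0 ∨ f_t j ℓ ≠ 0) k m →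
      ∀ ℓ, f k ℓ = f_t k ℓ)
    (hu : ∀ k, Relation.ReflTransGen (fun ℓ j => f j ℓ ≠ 0 ∨ f_t j ℓ ≠ 0) k m →
      u k = u_t k)
    (hc : ∀ k, Relation.ReflTransGen (fun ℓ j => f j ℓ ≠ 0 ∨ f_t j ℓ ≠ 0) k m →
      c k = c_t k) :
    x m = x_t m := by
  have key : ∀ k : Fin n,
      Relation.ReflTransGen (fun ℓ j => f j ℓ ≠ 0 ∨ f_t j ℓ ≠ 0) k m → x k = x_t k := by
    intro k
    induction k using WellFoundedLT.induction with
    | ind k ih =>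
      intro hk
      funext t
      rw [hx.2 k t, hx_t.2 k t, hu k hk, hc k hk]
      have hs : ∀ τ : ℝ, ∑ ℓ, f k ℓ (x ℓ τ) = ∑ ℓ, f_t k ℓ (x_t ℓ τ) := by
        intro τ
        refine Finset.sum_congr rfl fun ℓ _ => ?_
        rw [← hf k hk ℓ]
        by_cases h0 : f k ℓ = 0
        · simp [h0]
        · have hlt : ℓ < k := by
            by_contra h
            exact h0 (hdag k ℓ h)
          rw [ih ℓ hlt (Relation.ReflTransGen.head (Or.inl h0) hk)]
      simp only [hs]
  exact key m Relation.ReflTransGen.refl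
end

section
/- Consider the network model on a DAG with n nodes, let i be a sink (f k i = 0 for every k), and let f̃ be another family of continuous edge functions (also satisfying the topological-order constraint) that agrees with f on every edge not entering i, i.e., f k ℓ = f̃ k ℓ whenever k ≠ i. Then for any constant inputs u, initial conditions c, any trajectory x for (f, u, c), and any trajectory x̃ for (f̃, u, c), one has x j = x̃ j for every node j ≠ i. (Consequently, the edge functions entering a sink cannot be identified unless that sink itself is measured: measuring all sinks is necessary.) -/
theorem stmt_6 (n : ℕ) (f f_t : Fin n → Fin n → ℝ → ℝ)
    (hdag : ∀ i j, ¬ j < i → f i j = 0)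
    (hdag' : ∀ i j, ¬ j < i → f_t i j = 0)
    (hcont : ∀ i j, Continuous (f i j))
    (hcont' : ∀ i j, Continuous (f_t i j))
    (i : Fin n) (hsink : ∀ k, f k i = 0)
    (hagree : ∀ k ℓ, k ≠ i → f k ℓ = f_t k ℓ)
    (u c : Fin n → ℝ) (x x_t : Fin n → ℝ → ℝ)
    (hx : IsTrajectory n f u c x) (hx_t : IsTrajectory n f_t u c x_t) :
    ∀ j, j ≠ i → x j = x_t j := by
  intro j
  induction j using WellFoundedLT.induction with
  | ind j ih =>
    intro hj
    funext t
    rw [hx.2 j t, hx_t.2 j t]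
    have key : ∀ τ, ∑ ℓ, f j ℓ (x ℓ τ) = ∑ ℓ, f_t j ℓ (x_t ℓ τ) := by
      intro τ
      refine Finset.sum_congr rfl fun ℓ _ => ?_
      rw [← hagree j ℓ hj]
      by_cases hl : ℓ = i
      · subst hl
        simp [hsink j]
      · by_cases hlt : ℓ < j
        · rw [ih ℓ hlt hl]
        · simp [hdag j ℓ hlt]
    simp only [key]
end

section
/- (Proposition 1, sufficiency with zero initial conditions and constant inputs.) Consider the path-graph model with n ≥ 1 and two families of edge functions f, f̃ : Fin n → (ℝ → ℝ) such that each f i and each f̃ i is analytic on all of ℝ, vanishes at 0 (f i 0 = 0, f̃ i 0 = 0), and is not identically zero. Suppose X and X̃ assign to every constant input vector u : Fin (n+1) → ℝ a trajectory X u for (f, u, 0) and a trajectory X̃ u for (f̃, u, 0) (zero initial conditions). If the sink trajectories coincide, i.e., X u n t = X̃ u n t for every u and every t ≥ 0, then f i = f̃ i for every i. -/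
/-- A trajectory of the continuous-time path-graph model with nodes `Fin (n+1)`,
edge functions `f i` on the edge from node `i` to node `i+1`, constant inputs `u`
and initial conditions `c`. -/
def IsPathTrajectory (n : ℕ) (f : Fin n → ℝ → ℝ) (u c : Fin (n + 1) → ℝ)
    (x : Fin (n + 1) → ℝ → ℝ) : Prop :=
  (∀ j, Continuous (x j)) ∧
  (∀ t : ℝ, x 0 t = u 0 * t + c 0) ∧
  ∀ (i : Fin n) (t : ℝ),
    x i.succ t = (∫ τ in (0:ℝ)..t, f i (x i.castSucc τ)) + u i.succ * t + c i.succ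

theorem path_local {n : ℕ} {f : Fin n → ℝ → ℝ} {u u' : Fin (n + 1) → ℝ}
    {x x' : Fin (n + 1) → ℝ → ℝ} (h : IsPathTrajectory n f u 0 x)
    (h' : IsPathTrajectory n f u' 0 x') (j : Fin (n + 1)) :
    (∀ k, k < j → u k = u' k) → ∀ t, x' j t = x j t + (u' j - u j) * t := by
  induction j using Fin.induction with
  | zero =>
    intro _ t
    rw [h.2.1, h'.2.1]; simp; ring
  | succ i ih =>
    intro hk t
    have e : ∀ t, x' i.castSucc t = x i.castSucc t := by
      intro t
      rw [ih (fun k hki => hk k (hki.trans i.castSucc_lt_succ)) t, hk _ i.castSucc_lt_succ]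
      ring
    rw [h.2.2, h'.2.2]
    simp only [e]; ring

theorem path_periodic {g d : ℝ → ℝ} (hg0 : g 0 = 0) (hd : Continuous d) (hd0 : d 0 = 0)
    (hp : ∀ t, 0 < t → ∀ s, g (s + d t) = g s) {T : ℝ} (hT : 0 < T) (hdT : d T ≠ 0) :
    g = 0 := by
  funext x
  obtain ⟨m, hm⟩ := exists_nat_ge |x / d T|
  have hN : (0:ℝ) < (m:ℝ) + 1 := by positivity
  have h0 : (0:ℝ) ≤ |x / d T| / (m + 1) := by positivity
  have h1 : |x / d T| / (m + 1) ≤ 1 := by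
    rw [div_le_one hN]; linarith
  have hmem : |x / d T| / (m + 1) * d T ∈ Set.uIcc (d 0) (d T) := by
    rw [hd0, Set.mem_uIcc]
    rcases le_total 0 (d T) with h | h
    · left; constructor <;> nlinarith
    · right; constructor <;> nlinarith
  obtain ⟨t, ht, hte⟩ := intermediate_value_uIcc (a := 0) (b := T) hd.continuousOn hmem
  rw [Set.uIcc_of_le hT.le] at ht
  have per : Function.Periodic g (d t) := by
    rcases ht.1.eq_or_lt with h | h
    · intro s; rw [← h, hd0, add_zero]
    · exact hp t h
  have key : ((m + 1 : ℕ) : ℝ) * d t = |x / d T| * d T := by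
    rw [hte]; push_cast; field_simp
  have e1 := per.nat_mul_eq (m + 1)
  have e2 := per.neg.nat_mul_eq (m + 1)
  rw [mul_neg, key] at e2
  rw [key] at e1
  rcases abs_choice (x / d T) with h | h
  · rw [h, div_mul_cancel₀ _ hdT, hg0] at e1; exact e1
  · rw [h, neg_mul, neg_neg, div_mul_cancel₀ _ hdT, hg0] at e2; exact e2

theorem path_deriv {a b : ℝ → ℝ} (ha : Continuous a) (hb : Continuous b)
    (h : ∀ t : ℝ, 0 ≤ t → ∫ τ in (0:ℝ)..t, a τ = ∫ τ in (0:ℝ)..t, b τ) {t : ℝ} (ht : 0 < t) :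
    a t = b t := by
  have h1 := (ha.integral_hasStrictDerivAt 0 t).hasDerivAt
  have h2 := (hb.integral_hasStrictDerivAt 0 t).hasDerivAt
  refine (h1.congr_of_eventuallyEq ?_).unique h2
  filter_upwards [lt_mem_nhds ht] with s hs
  exact (h s hs.le).symm

theorem stmt_7 (n : ℕ) (hn : 1 ≤ n) (f f_t : Fin n → ℝ → ℝ)
    (hf : ∀ i, AnalyticOn ℝ (f i) Set.univ) (hf0 : ∀ i, f i 0 = 0)
    (hfne : ∀ i, f i ≠ 0)
    (hft : ∀ i, AnalyticOn ℝ (f_t i) Set.univ) (hft0 : ∀ i, f_t i 0 = 0)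
    (hftne : ∀ i, f_t i ≠ 0)
    (X X_t : (Fin (n + 1) → ℝ) → Fin (n + 1) → ℝ → ℝ)
    (hX : ∀ u, IsPathTrajectory n f u 0 (X u))
    (hX_t : ∀ u, IsPathTrajectory n f_t u 0 (X_t u))
    (hsink : ∀ (u : Fin (n + 1) → ℝ) (t : ℝ), 0 ≤ t →
      X u (Fin.last n) t = X_t u (Fin.last n) t) :
    ∀ i, f i = f_t i := by
  have hc : ∀ i, Continuous (f i) := fun i => continuousOn_univ.1 (hf i).continuousOn
  have hct : ∀ i, Continuous (f_t i) := fun i => continuousOn_univ.1 (hft i).continuousOn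
  have z : ∀ g : Fin n → ℝ → ℝ, (∀ i, g i 0 = 0) → IsPathTrajectory n g 0 0 0 := by
    intro g hg
    refine ⟨fun j => continuous_const, fun t => by simp, fun i t => by simp [hg]⟩
  -- derivative form of equality at the successor node
  have D : ∀ i : Fin n, (∀ u t, 0 ≤ t → X u i.succ t = X_t u i.succ t) →
      ∀ u t, 0 < t → f i (X u i.castSucc t) = f_t i (X_t u i.castSucc t) := by
    intro i h u t ht
    refine path_deriv (a := fun t => f i (X u i.castSucc t))
      (b := fun t => f_t i (X_t u i.castSucc t)) ((hc i).comp ((hX u).1 _))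
      ((hct i).comp ((hX_t u).1 _)) ?_ ht
    intro s hs
    have := h u s hs
    rw [(hX u).2.2, (hX_t u).2.2] at this
    linarith
  have A : ∀ i : Fin n, (∀ u t, 0 ≤ t → X u i.succ t = X_t u i.succ t) → f i = f_t i := by
    intro i h
    funext s
    have := D i h (Pi.single i.castSucc s) 1 one_pos
    have hk : ∀ k, k < i.castSucc →
        (0 : Fin (n + 1) → ℝ) k = (Pi.single i.castSucc s : Fin (n + 1) → ℝ) k := by
      intro k hk
      simp [Pi.single_eq_of_ne hk.ne]
    rw [path_local (z f hf0) (hX _) _ hk, path_local (z f_t hft0) (hX_t _) _ hk] at this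
    simpa using this
  have P : ∀ j : Fin (n + 1), ∀ u t, 0 ≤ t → X u j t = X_t u j t := by
    intro j
    induction j using Fin.reverseInduction with
    | last => exact hsink
    | cast i ih =>
      intro u T hT
      have x0 : ∀ j, X u j 0 = 0 := by
        intro j
        refine Fin.cases ?_ (fun i => ?_) j
        · rw [(hX u).2.1]; simp
        · rw [(hX u).2.2]; simp
      have x0' : ∀ j, X_t u j 0 = 0 := by
        intro j
        refine Fin.cases ?_ (fun i => ?_) j
        · rw [(hX_t u).2.1]; simp
        · rw [(hX_t u).2.2]; simp
      rcases hT.eq_or_lt with h | hT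
      · rw [← h, x0, x0']
      by_contra hne
      refine hfne i (path_periodic (d := fun t => X u i.castSucc t - X_t u i.castSucc t)
        (hf0 i) (((hX u).1 _).sub ((hX_t u).1 _)) (by simp [x0, x0']) ?_ hT (sub_ne_zero.2 hne))
      intro t ht s
      have hk : ∀ v, ∀ k, k < i.castSucc → u k = Function.update u i.castSucc v k := by
        intro v k hk
        rw [Function.update_of_ne hk.ne]
      have := D i ih (Function.update u i.castSucc
        (u i.castSucc + (s - X_t u i.castSucc t) / t)) t ht
      rw [path_local (hX u) (hX _) _ (hk _), path_local (hX_t u) (hX_t _) _ (hk _),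
        ← A i ih] at this
      simp only [Function.update_self, add_sub_cancel_left, div_mul_cancel₀ _ ht.ne'] at this
      rw [add_sub_cancel] at this
      rw [← this]; congr 1; ring
  exact fun i => A i (P _)
end

section
/- (Proposition 1, sufficiency with multiple initial conditions and zero excitation.) Consider the path-graph model with n ≥ 1 and two families of edge functions f, f̃ : Fin n → (ℝ → ℝ) such that each f i and each f̃ i is analytic on all of ℝ, vanishes at 0 (f i 0 = 0, f̃ i 0 = 0), and is not identically zero. Suppose X and X̃ assign to every initial condition vector c : Fin (n+1) → ℝ a trajectory X c for (f, 0, c) and a trajectory X̃ c for (f̃, 0, c) (zero inputs). If the sink trajectories coincide, i.e., X c n t = X̃ c n t for every c and every t ≥ 0, then f i = f̃ i for every i. -/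
theorem aux_int (g h : ℝ → ℝ) (k : ℝ) (hg : Continuous g) (hh : Continuous h)
    (H : ∀ t : ℝ, 0 ≤ t → (∫ τ in (0:ℝ)..t, g τ) + k = (∫ τ in (0:ℝ)..t, h τ) + k) :
    ∀ t : ℝ, 0 ≤ t → g t = h t := by
  intro t ht
  have h1 : HasDerivWithinAt (fun t => ∫ τ in (0:ℝ)..t, g τ) (g t) (Set.Ici t) t :=
    (hg.integral_hasStrictDerivAt 0 t).hasDerivAt.hasDerivWithinAt
  have h2 : HasDerivWithinAt (fun t => ∫ τ in (0:ℝ)..t, h τ) (h t) (Set.Ici t) t :=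
    (hh.integral_hasStrictDerivAt 0 t).hasDerivAt.hasDerivWithinAt
  have h3 : HasDerivWithinAt (fun t => ∫ τ in (0:ℝ)..t, g τ) (h t) (Set.Ici t) t := by
    refine h2.congr (fun y hy => ?_) ?_
    · have := H y (le_trans ht hy)
      linarith
    · have := H t ht
      linarith
  exact (uniqueDiffOn_Ici t t Set.self_mem_Ici).eq_deriv _ h1 h3

theorem aux_const (f : ℝ → ℝ) (D : ℝ) (hD : 0 < D)
    (H : ∀ y, |y| ≤ D → ∀ s, f (s + y) = f s) : ∀ x, f x = f 0 := by
  intro x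
  obtain ⟨N, hN⟩ := exists_nat_gt (|x| / D)
  have hN0 : (0:ℝ) < N := lt_of_le_of_lt (by positivity) hN
  have hs : |x / N| ≤ D := by
    rw [abs_div, Nat.abs_cast, div_le_iff₀ hN0]
    rw [div_lt_iff₀ hD] at hN
    linarith
  have hk : ∀ k : ℕ, f (k * (x / N)) = f 0 := by
    intro k
    induction k with
    | zero => simp
    | succ k ih =>
      rw [← ih, ← H (x / N) hs (k * (x / N))]
      congr 1
      push_cast
      ring
  have := hk N
  rwa [mul_div_cancel₀ _ hN0.ne'] at this

theorem aux_period (f d : ℝ → ℝ) (hd : Continuous d) (hd0 : d 0 = 0)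
    (H : ∀ t, 0 ≤ t → ∀ s, f (s + d t) = f s) (t : ℝ) (ht : 0 ≤ t) (hdt : d t ≠ 0) :
    ∀ x, f x = f 0 := by
  have hI : ∀ y ∈ Set.uIcc (0:ℝ) (d t), ∀ s, f (s + y) = f s := by
    intro y hy s
    have := intermediate_value_uIcc (a := 0) (b := t) hd.continuousOn
    rw [hd0] at this
    obtain ⟨r, hr, rfl⟩ := this hy
    rw [Set.uIcc_of_le ht] at hr
    exact H r hr.1 s
  refine aux_const f |d t| (abs_pos.mpr hdt) ?_
  intro y hy s
  have hcase : y ∈ Set.uIcc (0:ℝ) (d t) ∨ -y ∈ Set.uIcc (0:ℝ) (d t) := by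
    simp only [Set.mem_uIcc]
    grind
  rcases hcase with h | h
  · exact hI y h s
  · have := hI (-y) h (s + y)
    rw [← this]
    congr 1
    ring

theorem aux_shift (n : ℕ) (f : Fin n → ℝ → ℝ) (c c' : Fin (n + 1) → ℝ)
    (x x' : Fin (n + 1) → ℝ → ℝ) (hx : IsPathTrajectory n f 0 c x)
    (hx' : IsPathTrajectory n f 0 c' x') (j : Fin (n + 1)) :
    (∀ i < j, c i = c' i) → ∀ t, x j t - c j = x' j t - c' j := by
  induction j using Fin.induction with
  | zero =>
    intro _ t
    rw [hx.2.1, hx'.2.1]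
    simp
  | succ i ih =>
    intro h t
    have e : x i.castSucc = x' i.castSucc := by
      funext t
      have h1 := ih (fun k hk => h k (hk.trans i.castSucc_lt_succ)) t
      have h2 := h i.castSucc i.castSucc_lt_succ
      linarith
    rw [hx.2.2, hx'.2.2, e]
    simp

theorem aux_init (n : ℕ) (f : Fin n → ℝ → ℝ) (c : Fin (n + 1) → ℝ)
    (x : Fin (n + 1) → ℝ → ℝ) (hx : IsPathTrajectory n f 0 c x) (j : Fin (n + 1)) :
    x j 0 = c j := by
  cases j using Fin.cases with
  | zero => rw [hx.2.1]; simp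
  | succ i => rw [hx.2.2]; simp

theorem stmt_8 (n : ℕ) (hn : 1 ≤ n) (f f_t : Fin n → ℝ → ℝ)
    (hf : ∀ i, AnalyticOn ℝ (f i) Set.univ) (hf0 : ∀ i, f i 0 = 0)
    (hfne : ∀ i, f i ≠ 0)
    (hft : ∀ i, AnalyticOn ℝ (f_t i) Set.univ) (hft0 : ∀ i, f_t i 0 = 0)
    (hftne : ∀ i, f_t i ≠ 0)
    (X X_t : (Fin (n + 1) → ℝ) → Fin (n + 1) → ℝ → ℝ)
    (hX : ∀ c, IsPathTrajectory n f 0 c (X c))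
    (hX_t : ∀ c, IsPathTrajectory n f_t 0 c (X_t c))
    (hsink : ∀ (c : Fin (n + 1) → ℝ) (t : ℝ), 0 ≤ t →
      X c (Fin.last n) t = X_t c (Fin.last n) t) :
    ∀ i, f i = f_t i := by
  have cf : ∀ i, Continuous (f i) := fun i => continuousOn_univ.mp (hf i).continuousOn
  have cft : ∀ i, Continuous (f_t i) := fun i => continuousOn_univ.mp (hft i).continuousOn
  have A : ∀ i : Fin n, (∀ c t, 0 ≤ t → X c i.succ t = X_t c i.succ t) →
      ∀ c t, 0 ≤ t → f i (X c i.castSucc t) = f_t i (X_t c i.castSucc t) := by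
    intro i h c
    refine aux_int (fun t => f i (X c i.castSucc t)) (fun t => f_t i (X_t c i.castSucc t))
      (c i.succ) ((cf i).comp ((hX c).1 _)) ((cft i).comp ((hX_t c).1 _)) ?_
    intro t ht
    have := h c t ht
    rw [(hX c).2.2, (hX_t c).2.2] at this
    simpa using this
  have B : ∀ i : Fin n, (∀ c t, 0 ≤ t → X c i.succ t = X_t c i.succ t) → f i = f_t i := by
    intro i h
    funext s
    have := A i h (fun _ => s) 0 le_rfl
    rwa [aux_init n f _ _ (hX _), aux_init n f_t _ _ (hX_t _)] at this
  have P : ∀ j : Fin (n + 1), ∀ c t, 0 ≤ t → X c j t = X_t c j t := by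
    intro j
    induction j using Fin.reverseInduction with
    | last => exact hsink
    | cast i ih =>
      intro c t ht
      by_contra hne
      apply hfne i
      have hB := B i ih
      have := aux_period (f i) (fun t => X c i.castSucc t - X_t c i.castSucc t)
        (((hX c).1 _).sub ((hX_t c).1 _))
        (by simp [aux_init n f _ _ (hX _), aux_init n f_t _ _ (hX_t _)]) ?_ t ht
        (sub_ne_zero.mpr hne)
      · funext x
        rw [this x, hf0]
        rfl
      · intro r hr s
        set v := s - X_t c i.castSucc r + c i.castSucc with hv
        have hc : ∀ k < i.castSucc, c k = Function.update c i.castSucc v k := by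
          intro k hk
          rw [Function.update_of_ne hk.ne]
        have h1 := aux_shift n f c _ _ _ (hX c) (hX (Function.update c i.castSucc v)) _ hc r
        have h2 := aux_shift n f_t c _ _ _ (hX_t c)
          (hX_t (Function.update c i.castSucc v)) _ hc r
        have h3 := A i ih (Function.update c i.castSucc v) r hr
        rw [Function.update_self] at h1 h2
        rw [← hB] at h3
        convert h3 using 2 <;> linarith
  exact fun i => B i (P i.succ)
end

section
/- (Theorem 2 for DAGs, zero initial conditions and constant inputs.) Consider the network model on a DAG with n nodes and two families of edge functions f, f̃ such that: (i) every f i j and every f̃ i j is analytic on all of ℝ and satisfies f i j 0 = 0 and f̃ i j 0 = 0; (ii) f i j = 0 if and only if f̃ i j = 0 (the graph topology is known); (iii) every nonzero edge function is purely nonlinear: if f i j ≠ 0 then there is no a ∈ ℝ with f i j = (fun s => a * s), and likewise for f̃ i j. Suppose X and X̃ assign to every constant input vector u : Fin n → ℝ a trajectory X u for (f, u, 0) and a trajectory X̃ u for (f̃, u, 0). If for every sink i one has X u i t = X̃ u i t for every u and every t ≥ 0, then f = f̃. -/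
theorem aux_lin (g : ℝ → ℝ) (hg : AnalyticOn ℝ g Set.univ) (g0 : g 0 = 0)
    (d : ℝ → ℝ) (hd : Continuous d) (d0 : d 0 = 0) (T : ℝ) (hT : 0 < T) (hdT : d T ≠ 0)
    (h : ∀ t, 0 < t → ∀ s, g (s + d t) - g s = g (d t)) :
    ∃ a : ℝ, g = fun s => a * s := by
  have hgN : AnalyticOnNhd ℝ g Set.univ := (isOpen_univ.analyticOn_iff_analyticOnNhd).1 hg
  have hdiff : Differentiable ℝ g := fun x => (hgN x (Set.mem_univ x)).differentiableAt
  have hD : AnalyticOnNhd ℝ (deriv g) Set.univ := hgN.deriv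
  have key : ∀ e ∈ Set.uIcc (d 0) (d T), deriv g e = deriv g 0 := by
    intro e he
    obtain ⟨t, ht, rfl⟩ := intermediate_value_uIcc (hd.continuousOn) he
    rw [Set.uIcc_of_le hT.le] at ht
    rcases ht.1.eq_or_lt with h0 | h0
    · rw [← h0, d0]
    · have h1 : (fun s => g (s + d t)) = fun s => g s + g (d t) := by
        funext s; linarith [h t h0 s]
      have h2 := congrArg (fun F => deriv F 0) h1
      simpa [deriv_comp_add_const] using h2
  have hev : deriv g =ᶠ[nhds (d T / 2)] fun _ => deriv g 0 := by
    have : Set.uIcc (d 0) (d T) ∈ nhds (d T / 2) := by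
      rw [d0]
      rcases lt_or_gt_of_ne hdT with h | h
      · rw [Set.uIcc_of_ge h.le]; exact Icc_mem_nhds (by linarith) (by linarith)
      · rw [Set.uIcc_of_le h.le]; exact Icc_mem_nhds (by linarith) (by linarith)
    filter_upwards [this] with e he using key e he
  have hc : deriv g = fun _ => deriv g 0 :=
    hD.eq_of_eventuallyEq analyticOnNhd_const hev
  refine ⟨deriv g 0, ?_⟩
  have hz : ∀ x y, (fun s => g s - deriv g 0 * s) x = (fun s => g s - deriv g 0 * s) y := by
    apply is_const_of_deriv_eq_zero
    · exact hdiff.sub (differentiable_id.const_mul _)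
    · intro x
      have h1 := (hdiff x).hasDerivAt.sub ((hasDerivAt_id x).const_mul (deriv g 0))
      have h2 := h1.deriv
      rw [congrFun hc x] at h2
      have h3 : (fun s => g s - deriv g 0 * s) = g - fun y => deriv g 0 * id y := rfl
      rw [h3, h2]; simp
  funext s
  have := hz s 0
  simp [g0] at this
  linarith

theorem aux_shift_s11 {n : ℕ} {f : Fin n → Fin n → ℝ → ℝ}
    (hdag : ∀ i j, ¬ j < i → f i j = 0)
    {X : (Fin n → ℝ) → Fin n → ℝ → ℝ} (hX : ∀ u, IsTrajectory n f u 0 (X u))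
    (u v : Fin n → ℝ) (l : Fin n) (h : ∀ k < l, u k = v k) (t : ℝ) :
    X u l t = X v l t + (u l - v l) * t := by
  induction l using WellFoundedLT.induction generalizing t with
  | ind l ih =>
    rw [(hX u).2 l t, (hX v).2 l t]
    have : (fun τ => ∑ k, f l k (X u k τ)) = fun τ => ∑ k, f l k (X v k τ) := by
      funext τ
      refine Finset.sum_congr rfl fun k _ => ?_
      by_cases hk : k < l
      · rw [ih k hk (fun k' hk' => h k' (hk'.trans hk)) τ, h k hk]; simp
      · simp [hdag l k hk]
    rw [this]; ring

theorem aux_zero {n : ℕ} {f : Fin n → Fin n → ℝ → ℝ}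
    (hdag : ∀ i j, ¬ j < i → f i j = 0) (h0 : ∀ i j, f i j 0 = 0)
    {X : (Fin n → ℝ) → Fin n → ℝ → ℝ} (hX : ∀ u, IsTrajectory n f u 0 (X u))
    (l : Fin n) (t : ℝ) : X 0 l t = 0 := by
  induction l using WellFoundedLT.induction generalizing t with
  | ind l ih =>
    rw [(hX 0).2 l t]
    have : (fun τ => ∑ k, f l k (X 0 k τ)) = fun τ => 0 := by
      funext τ
      refine Finset.sum_eq_zero fun k _ => ?_
      by_cases hk : k < l
      · rw [ih k hk τ, h0]
      · simp [hdag l k hk]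
    rw [this]; simp

theorem aux_deriv {n : ℕ} {f : Fin n → Fin n → ℝ → ℝ}
    (hc : ∀ i j, Continuous (f i j)) {u : Fin n → ℝ} {x : Fin n → ℝ → ℝ}
    (hx : IsTrajectory n f u 0 x) (i : Fin n) (t : ℝ) :
    HasDerivAt (x i) ((∑ k, f i k (x k t)) + u i) t := by
  have hS : Continuous fun τ => ∑ k, f i k (x k τ) :=
    continuous_finsetSum _ fun k _ => (hc i k).comp (hx.1 k)
  have h1 := (hS.integral_hasStrictDerivAt 0 t).hasDerivAt
  have h2 := (h1.add ((hasDerivAt_id t).const_mul (u i))).add_const ((0 : Fin n → ℝ) i)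
  have h3 : x i = fun t => (∫ τ in (0:ℝ)..t, ∑ k, f i k (x k τ)) + u i * t + (0 : Fin n → ℝ) i :=
    funext (hx.2 i)
  rw [h3]
  simpa using h2

theorem stmt_11 (n : ℕ) (f f_t : Fin n → Fin n → ℝ → ℝ)
    (hdag : ∀ i j, ¬ j < i → f i j = 0)
    (hdag' : ∀ i j, ¬ j < i → f_t i j = 0)
    (hana : ∀ i j, AnalyticOn ℝ (f i j) Set.univ)
    (hana' : ∀ i j, AnalyticOn ℝ (f_t i j) Set.univ)
    (h0 : ∀ i j, f i j 0 = 0) (h0' : ∀ i j, f_t i j 0 = 0)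
    (htop : ∀ i j, f i j = 0 ↔ f_t i j = 0)
    (hnl : ∀ i j, f i j ≠ 0 → ¬ ∃ a : ℝ, f i j = fun s => a * s)
    (hnl' : ∀ i j, f_t i j ≠ 0 → ¬ ∃ a : ℝ, f_t i j = fun s => a * s)
    (X X_t : (Fin n → ℝ) → Fin n → ℝ → ℝ)
    (hX : ∀ u, IsTrajectory n f u 0 (X u))
    (hX_t : ∀ u, IsTrajectory n f_t u 0 (X_t u))
    (hsinks : ∀ i : Fin n, (∀ k, f k i = 0) →
      ∀ (u : Fin n → ℝ) (t : ℝ), 0 ≤ t → X u i t = X_t u i t) :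
    f = f_t := by
  have hcont : ∀ i j, Continuous (f i j) := fun i j => continuousOn_univ.1 (hana i j).continuousOn
  have hcont' : ∀ i j, Continuous (f_t i j) := fun i j =>
    continuousOn_univ.1 (hana' i j).continuousOn
  have lem : ∀ i : Fin n, (∀ u, ∀ t > 0, X u i t = X_t u i t) → ∀ m : Fin n,
      f i m = f_t i m ∧ (f i m ≠ 0 → ∀ u, ∀ t > 0, X u m t = X_t u m t) := by
    intro i hi
    have hsum : ∀ u, ∀ t > 0, ∑ k, f i k (X u k t) = ∑ k, f_t i k (X_t u k t) := by
      intro u t ht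
      have h1 := aux_deriv hcont (hX u) i t
      have h2 := aux_deriv hcont' (hX_t u) i t
      have he : X u i =ᶠ[nhds t] X_t u i := by
        filter_upwards [lt_mem_nhds ht] with s hs using hi u s hs
      have := (h1.congr_of_eventuallyEq he.symm).unique h2
      linarith
    intro m
    induction m using WellFoundedGT.induction with
    | ind m ih =>
      -- edges above `m` agree; isolate the lower part
      have hterm : ∀ k > m, ∀ u, ∀ t > 0, f i k (X u k t) = f_t i k (X_t u k t) := by
        intro k hk u t ht
        obtain ⟨h1, h2⟩ := ih k hk
        by_cases hz : f i k = 0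
        · rw [← h1, hz]; rfl
        · rw [← h1, h2 hz u t ht]
      have hdiff : ∀ u v, ∀ t > 0, (∀ k < m, u k = v k) →
          f i m (X u m t) - f i m (X v m t) = f_t i m (X_t u m t) - f_t i m (X_t v m t) := by
        intro u v t ht huv
        have h1 := hsum u t ht
        have h2 := hsum v t ht
        have h3 : ∑ k, ((f i k (X u k t) - f i k (X v k t))
            - (f_t i k (X_t u k t) - f_t i k (X_t v k t))) = 0 := by
          simp only [Finset.sum_sub_distrib]; linarith
        rw [Finset.sum_eq_single m] at h3
        · linarith
        · intro k _ hk
          rcases lt_or_gt_of_ne hk with hk | hk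
          · have hh : ∀ k' < k, u k' = v k' := fun k' hk' => huv k' (hk'.trans hk)
            rw [aux_shift_s11 hdag hX u v k hh t, aux_shift_s11 hdag' hX_t u v k hh t, huv k hk]
            simp
          · rw [hterm k hk u t ht, hterm k hk v t ht]; simp
        · simp
      have hfeq : f i m = f_t i m := by
        funext s
        have hh : ∀ k < m, (Pi.single m s : Fin n → ℝ) k = (0 : Fin n → ℝ) k := by
          intro k hk; simp [hk.ne]
        have h1 := hdiff (Pi.single m s) 0 1 one_pos hh
        rw [aux_shift_s11 hdag hX _ 0 m hh 1, aux_shift_s11 hdag' hX_t _ 0 m hh 1,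
          aux_zero hdag h0 hX, aux_zero hdag' h0' hX_t] at h1
        simpa [h0, h0'] using h1
      refine ⟨hfeq, fun hne u T hT => ?_⟩
      by_contra hcon
      refine hnl i m hne (aux_lin (f i m) (hana i m) (h0 i m) (fun t => X u m t - X_t u m t)
        (((hX u).1 m).sub ((hX_t u).1 m)) ?_ T hT (sub_ne_zero.2 hcon) ?_)
      · simp [(hX u).2 m 0, (hX_t u).2 m 0]
      · intro t ht s
        have gen : ∀ r : ℝ, ∃ v : Fin n → ℝ, (∀ k < m, v k = u k) ∧
            X_t v m t = r ∧ X v m t = r + (X u m t - X_t u m t) := by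
          intro r
          refine ⟨Function.update u m (u m + (r - X_t u m t) / t), ?_, ?_, ?_⟩
          · intro k hk; simp [hk.ne]
          · rw [aux_shift_s11 hdag' hX_t _ u m (fun k hk => by simp [hk.ne]) t]
            simp; field_simp; ring
          · rw [aux_shift_s11 hdag hX _ u m (fun k hk => by simp [hk.ne]) t]
            simp; field_simp; ring
        obtain ⟨v, hv, hv1, hv2⟩ := gen s
        obtain ⟨w, hw, hw1, hw2⟩ := gen 0
        have h1 := hdiff v w t ht (fun k hk => (hv k hk).trans (hw k hk).symm)
        rw [← hfeq, hv1, hv2, hw1, hw2, h0, zero_add] at h1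
        linarith
  have hall : ∀ i : Fin n, ∀ u, ∀ t > 0, X u i t = X_t u i t := by
    intro i
    induction i using WellFoundedGT.induction with
    | ind i ih =>
      by_cases hs : ∀ k, f k i = 0
      · intro u t ht; exact hsinks i hs u t ht.le
      · push Not at hs
        obtain ⟨k, hk⟩ := hs
        have hlt : i < k := by
          by_contra hc; exact hk (hdag k i hc)
        exact (lem k (ih k hlt) i).2 hk
  funext i j
  exact (lem i (hall i) j).1
end

section
/- (Theorem 2 for DAGs, multiple initial conditions and zero excitation.) Consider the network model on a DAG with n nodes and two families of edge functions f, f̃ such that: (i) every f i j and every f̃ i j is analytic on all of ℝ and satisfies f i j 0 = 0 and f̃ i j 0 = 0; (ii) f i j = 0 if and only if f̃ i j = 0 (the graph topology is known); (iii) every nonzero edge function is purely nonlinear: if f i j ≠ 0 then there is no a ∈ ℝ with f i j = (fun s => a * s), and likewise for f̃ i j. Suppose X and X̃ assign to every initial condition vector c : Fin n → ℝ a trajectory X c for (f, 0, c) and a trajectory X̃ c for (f̃, 0, c). If for every sink i one has X c i t = X̃ c i t for every c and every t ≥ 0, then f = f̃. -/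
lemma aux_linear (g : ℝ → ℝ) (hg : Continuous g) (h0 : g 0 = 0) (y : ℝ) (hy : y ≠ 0)
    (h : ∀ q ∈ Set.uIcc 0 y, ∀ s, g (s + q) - g s = g q) : ∃ a : ℝ, g = fun s => a * s := by
  let G : AddSubgroup ℝ :=
    { carrier := {q | ∀ s, g (s + q) - g s = g q}
      zero_mem' := by intro s; simp [h0]
      add_mem' := by
        intro a b ha hb s
        have h1 := ha s
        have h2 := hb (s + a)
        have h3 := hb a
        rw [← add_assoc]
        linarith
      neg_mem' := by
        intro a ha s
        have h1 := ha (s + -a)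
        have h2 := ha (-a)
        simp only [neg_add_cancel_right, neg_add_cancel] at h1 h2
        linarith }
  have hsub : ∀ q ∈ Set.uIcc 0 y, q ∈ G := fun q hq => h q hq
  have htop : ∀ x, x ∈ G := by
    intro x
    obtain ⟨N, hN⟩ := exists_nat_gt |x / y|
    have hNpos : (0:ℝ) < N := lt_of_le_of_lt (abs_nonneg _) hN
    obtain ⟨hN1, hN2⟩ := abs_lt.mp hN
    have key : ∀ r : ℝ, 0 ≤ r → r ≤ 1 → r * y ∈ G := by
      intro r hr0 hr1
      apply hsub
      rw [Set.mem_uIcc]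
      rcases le_total 0 y with hy0 | hy0
      · left; constructor <;> nlinarith
      · right; constructor <;> nlinarith
    have hr : (x / y / N) * y ∈ G := by
      rcases le_total 0 (x / y) with hh | hh
      · exact key _ (by positivity) (by rw [div_le_one hNpos]; exact hN2.le)
      · have := key (-(x / y) / N) (div_nonneg (by linarith) hNpos.le)
          (by rw [div_le_one hNpos]; linarith)
        have h2 := G.neg_mem this
        convert h2 using 1
        ring
    have h3 := G.nsmul_mem hr N
    convert h3 using 1
    rw [nsmul_eq_mul]
    field_simp
  have hadd : ∀ a b, g (a + b) = g a + g b := by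
    intro a b
    have h1 : g (a + b) - g a = g b := htop b a
    linarith
  let A : ℝ →+ ℝ := ⟨⟨g, h0⟩, hadd⟩
  refine ⟨g 1, funext fun s => ?_⟩
  have := (A.toRealLinearMap hg).map_smul s 1
  simp only [smul_eq_mul, mul_one] at this
  change g s = s * g 1 at this
  rw [this, mul_comm]

lemma aux_period_s12 (g : ℝ → ℝ) (hg : Continuous g) (h0 : g 0 = 0)
    (hnl : ¬ ∃ a : ℝ, g = fun s => a * s) (p : ℝ → ℝ) (hp : Continuous p) (hp0 : p 0 = 0)
    (h : ∀ t, 0 ≤ t → ∀ s r, g (s + p t) - g s = g (r + p t) - g r) :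
    ∀ t, 0 ≤ t → p t = 0 := by
  intro t ht
  by_contra hne
  apply hnl
  refine aux_linear g hg h0 (p t) hne ?_
  intro q hq s
  have hiv := intermediate_value_uIcc (a := 0) (b := t) (f := p) hp.continuousOn
  rw [hp0] at hiv
  obtain ⟨t', ht', rfl⟩ := hiv hq
  rw [Set.uIcc_of_le ht] at ht'
  have := h t' ht'.1 s 0
  simpa [h0] using this

lemma traj_rhs_cont {n : ℕ} {f : Fin n → Fin n → ℝ → ℝ} {u c : Fin n → ℝ} {x : Fin n → ℝ → ℝ}
    (hf : ∀ i j, Continuous (f i j)) (hx : IsTrajectory n f u c x) (j : Fin n) :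
    Continuous (fun τ => ∑ ℓ, f j ℓ (x ℓ τ)) :=
  continuous_finsetSum _ fun ℓ _ => (hf j ℓ).comp (hx.1 ℓ)

lemma traj_deriv {n : ℕ} {f : Fin n → Fin n → ℝ → ℝ} {c : Fin n → ℝ} {x : Fin n → ℝ → ℝ}
    (hf : ∀ i j, Continuous (f i j)) (hx : IsTrajectory n f 0 c x) (j : Fin n) (t : ℝ) :
    HasDerivAt (x j) (∑ ℓ, f j ℓ (x ℓ t)) t := by
  have h1 : x j = fun t => (∫ τ in (0:ℝ)..t, ∑ ℓ, f j ℓ (x ℓ τ)) + c j := by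
    funext t
    rw [hx.2 j t]; simp
  have hc := traj_rhs_cont hf hx j
  have h2 := (intervalIntegral.integral_hasDerivAt_right (hc.intervalIntegrable 0 t)
    (hc.stronglyMeasurableAtFilter _ _) hc.continuousAt).add_const (c j)
  rw [h1]
  exact h2

lemma traj_zero {n : ℕ} {f : Fin n → Fin n → ℝ → ℝ} {c : Fin n → ℝ} {x : Fin n → ℝ → ℝ}
    (hx : IsTrajectory n f 0 c x) (j : Fin n) : x j 0 = c j := by
  rw [hx.2 j 0]; simp

lemma traj_congr {n : ℕ} {f : Fin n → Fin n → ℝ → ℝ} (hdag : ∀ i j, ¬ j < i → f i j = 0)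
    {X : (Fin n → ℝ) → Fin n → ℝ → ℝ} (hX : ∀ c, IsTrajectory n f 0 c (X c)) (j : Fin n) :
    ∀ c c' : Fin n → ℝ, (∀ k, k < j → c k = c' k) → ∀ t, X c j t - c j = X c' j t - c' j := by
  induction j using WellFoundedLT.induction with
  | ind j ih =>
    intro c c' hcc t
    rw [(hX c).2 j t, (hX c').2 j t]
    have : ∀ τ, ∑ ℓ, f j ℓ (X c ℓ τ) = ∑ ℓ, f j ℓ (X c' ℓ τ) := by
      intro τ
      refine Finset.sum_congr rfl fun ℓ _ => ?_
      by_cases hl : ℓ < j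
      · have h1 := ih ℓ hl c c' (fun k hk => hcc k (hk.trans hl)) τ
        rw [hcc ℓ hl] at h1
        rw [sub_left_inj.mp h1]
      · rw [hdag j ℓ hl]; rfl
    simp [this]

theorem stmt_12 (n : ℕ) (f f_t : Fin n → Fin n → ℝ → ℝ)
    (hdag : ∀ i j, ¬ j < i → f i j = 0)
    (hdag' : ∀ i j, ¬ j < i → f_t i j = 0)
    (hana : ∀ i j, AnalyticOn ℝ (f i j) Set.univ)
    (hana' : ∀ i j, AnalyticOn ℝ (f_t i j) Set.univ)
    (h0 : ∀ i j, f i j 0 = 0) (h0' : ∀ i j, f_t i j 0 = 0)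
    (htop : ∀ i j, f i j = 0 ↔ f_t i j = 0)
    (hnl : ∀ i j, f i j ≠ 0 → ¬ ∃ a : ℝ, f i j = fun s => a * s)
    (hnl' : ∀ i j, f_t i j ≠ 0 → ¬ ∃ a : ℝ, f_t i j = fun s => a * s)
    (X X_t : (Fin n → ℝ) → Fin n → ℝ → ℝ)
    (hX : ∀ c, IsTrajectory n f 0 c (X c))
    (hX_t : ∀ c, IsTrajectory n f_t 0 c (X_t c))
    (hsinks : ∀ i : Fin n, (∀ k, f k i = 0) →
      ∀ (c : Fin n → ℝ) (t : ℝ), 0 ≤ t → X c i t = X_t c i t) :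
    f = f_t := by
  have hf : ∀ i j, Continuous (f i j) := fun i j =>
    continuousOn_univ.mp (hana i j).continuousOn
  have hf' : ∀ i j, Continuous (f_t i j) := fun i j =>
    continuousOn_univ.mp (hana' i j).continuousOn
  -- equality of node trajectories gives equality of right-hand sides
  have hrhs : ∀ i : Fin n, (∀ c t, 0 ≤ t → X c i t = X_t c i t) →
      ∀ c t, 0 ≤ t → ∑ ℓ, f i ℓ (X c ℓ t) = ∑ ℓ, f_t i ℓ (X_t c ℓ t) := by
    intro i hi c t ht
    have h1 := (traj_deriv hf (hX c) i t).hasDerivWithinAt (s := Set.Ici t)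
    have h2 := (traj_deriv hf' (hX_t c) i t).hasDerivWithinAt (s := Set.Ici t)
    have h3 := h2.congr (f₁ := X c i) (fun y hy => hi c y (ht.trans hy)) (hi c t ht)
    exact (uniqueDiffWithinAt_Ici t).eq_deriv _ h1 h3
  have hrow : ∀ i : Fin n, (∀ c t, 0 ≤ t → X c i t = X_t c i t) → ∀ ℓ, f i ℓ = f_t i ℓ := by
    intro i hi ℓ
    funext s
    have h1 := hrhs i hi (Pi.single ℓ s) 0 le_rfl
    simp only [traj_zero (hX _), traj_zero (hX_t _)] at h1
    rw [Finset.sum_eq_single ℓ, Finset.sum_eq_single ℓ] at h1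
    · simpa using h1
    · intro b _ hb; rw [Pi.single_eq_of_ne hb, h0']
    · simp
    · intro b _ hb; rw [Pi.single_eq_of_ne hb, h0]
    · simp
  have hpar : ∀ i : Fin n, (∀ c t, 0 ≤ t → X c i t = X_t c i t) →
      ∀ ℓ, f i ℓ ≠ 0 → ∀ c t, 0 ≤ t → X c ℓ t = X_t c ℓ t := by
    intro i hi ℓ
    induction ℓ using WellFoundedGT.induction with
    | ind ℓ ih =>
      intro hne c
      have hdiff : ∀ c t, 0 ≤ t → ∑ m, (f i m (X c m t) - f i m (X_t c m t)) = 0 := by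
        intro c t ht
        rw [Finset.sum_sub_distrib, hrhs i hi c t ht, sub_eq_zero]
        exact Finset.sum_congr rfl fun m _ => by rw [hrow i hi m]
      have hbig : ∀ m, ℓ < m → ∀ c t, 0 ≤ t → f i m (X c m t) - f i m (X_t c m t) = 0 := by
        intro m hm c t ht
        by_cases hz : f i m = 0
        · simp [hz]
        · rw [ih m hm hz c t ht, sub_self]
      have hshift : ∀ a t, 0 ≤ t →
          f i ℓ (X c ℓ t - c ℓ + a) - f i ℓ (X_t c ℓ t - c ℓ + a)
            = f i ℓ (X c ℓ t) - f i ℓ (X_t c ℓ t) := by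
        intro a t ht
        have e1 := hdiff c t ht
        have e2 := hdiff (Function.update c ℓ a) t ht
        rw [← Finset.add_sum_erase _ _ (Finset.mem_univ ℓ)] at e1 e2
        have e3 : ∑ m ∈ Finset.univ.erase ℓ, (f i m (X (Function.update c ℓ a) m t)
              - f i m (X_t (Function.update c ℓ a) m t))
            = ∑ m ∈ Finset.univ.erase ℓ, (f i m (X c m t) - f i m (X_t c m t)) := by
          refine Finset.sum_congr rfl fun m hm => ?_
          have hml : m ≠ ℓ := Finset.ne_of_mem_erase hm
          rcases lt_or_gt_of_ne hml with hlt | hgt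
          · have hc : ∀ k, k < m → Function.update c ℓ a k = c k := fun k hk =>
              Function.update_of_ne (hk.trans hlt).ne _ _
            have q1 := traj_congr hdag hX m _ _ hc t
            have q2 := traj_congr hdag' hX_t m _ _ hc t
            rw [Function.update_of_ne hml] at q1 q2
            rw [sub_left_inj.mp q1, sub_left_inj.mp q2]
          · rw [hbig m hgt _ t ht, hbig m hgt _ t ht]
        have hc : ∀ k, k < ℓ → Function.update c ℓ a k = c k := fun k hk =>
          Function.update_of_ne hk.ne _ _
        have q1 := traj_congr hdag hX ℓ _ _ hc t
        have q2 := traj_congr hdag' hX_t ℓ _ _ hc t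
        rw [Function.update_self] at q1 q2
        rw [← q1, ← q2, sub_add_cancel, sub_add_cancel]
        linarith
      have hfin := aux_period_s12 (f i ℓ) (hf i ℓ) (h0 i ℓ) (hnl i ℓ hne)
        (fun t => X c ℓ t - X_t c ℓ t) (((hX c).1 ℓ).sub ((hX_t c).1 ℓ))
        (by simp [traj_zero (hX c), traj_zero (hX_t c)]) (by
          intro t ht
          have hk : ∀ s, f i ℓ (s + (X c ℓ t - X_t c ℓ t)) - f i ℓ s
              = f i ℓ (X c ℓ t) - f i ℓ (X_t c ℓ t) := by
            intro s
            have := hshift (s - (X_t c ℓ t - c ℓ)) t ht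
            rw [← this]
            congr 2 <;> ring
          intro s r
          exact (hk s).trans (hk r).symm)
      intro t ht
      exact sub_eq_zero.mp (hfin t ht)
  have hall : ∀ i : Fin n, ∀ c t, 0 ≤ t → X c i t = X_t c i t := by
    intro i
    induction i using WellFoundedGT.induction with
    | ind i ih =>
      by_cases hs : ∀ k, f k i = 0
      · exact hsinks i hs
      · push Not at hs
        obtain ⟨k, hk⟩ := hs
        have hik : i < k := by
          by_contra hcon
          exact hk (hdag k i hcon)
        exact hpar k (ih k hik) i hk
  funext i j
  exact hrow i (hall i) j
end

section
/- (Non-identifiability with linear edges in the diamond DAG.) Let f21, f31, ψ : ℝ → ℝ be continuous and let k42, k43 ∈ ℝ with k42 ≠ 0 and k43 ≠ 0. Define f̃21 = f21 + (1/k42)·ψ and f̃31 = f31 − (1/k43)·ψ. Fix any u1, u2, u3, u4 ∈ ℝ and c1, c2, c3, c4 ∈ ℝ, and let x1, x2, x3, x4 : ℝ → ℝ and x̃1, x̃2, x̃3, x̃4 : ℝ → ℝ be continuous functions satisfying, for all t ∈ ℝ: x1 t = u1·t + c1; x2 t = (∫ τ in 0..t, f21 (x1 τ)) + u2·t + c2;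 x3 t = (∫ τ in 0..t, f31 (x1 τ)) + u3·t + c3; x4 t = (∫ τ in 0..t, (k42·x2 τ + k43·x3 τ)) + u4·t + c4; and the same equations for x̃ with f21, f31 replaced by f̃21, f̃31. Then x̃4 = x4. (Hence when the edges into the sink are linear, the functions f21 and f31 cannot be identified from measurements of the sink.) -/
theorem stmt_13 (f21 f31 ψ : ℝ → ℝ)
    (hf21 : Continuous f21) (hf31 : Continuous f31) (hψ : Continuous ψ)
    (k42 k43 : ℝ) (hk42 : k42 ≠ 0) (hk43 : k43 ≠ 0)
    (u1 u2 u3 u4 c1 c2 c3 c4 : ℝ)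
    (x1 x2 x3 x4 y1 y2 y3 y4 : ℝ → ℝ)
    (hx1c : Continuous x1) (hx2c : Continuous x2) (hx3c : Continuous x3)
    (hx4c : Continuous x4)
    (hy1c : Continuous y1) (hy2c : Continuous y2) (hy3c : Continuous y3)
    (hy4c : Continuous y4)
    (hx1 : ∀ t : ℝ, x1 t = u1 * t + c1)
    (hx2 : ∀ t : ℝ, x2 t = (∫ τ in (0:ℝ)..t, f21 (x1 τ)) + u2 * t + c2)
    (hx3 : ∀ t : ℝ, x3 t = (∫ τ in (0:ℝ)..t, f31 (x1 τ)) + u3 * t + c3)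
    (hx4 : ∀ t : ℝ, x4 t = (∫ τ in (0:ℝ)..t, (k42 * x2 τ + k43 * x3 τ)) + u4 * t + c4)
    (hy1 : ∀ t : ℝ, y1 t = u1 * t + c1)
    (hy2 : ∀ t : ℝ, y2 t =
      (∫ τ in (0:ℝ)..t, (f21 (y1 τ) + (1 / k42) * ψ (y1 τ))) + u2 * t + c2)
    (hy3 : ∀ t : ℝ, y3 t =
      (∫ τ in (0:ℝ)..t, (f31 (y1 τ) - (1 / k43) * ψ (y1 τ))) + u3 * t + c3)
    (hy4 : ∀ t : ℝ, y4 t = (∫ τ in (0:ℝ)..t, (k42 * y2 τ + k43 * y3 τ)) + u4 * t + c4) :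
    y4 = x4 := by
  have hxy : y1 = x1 := by
    funext t
    rw [hx1, hy1]
  subst hxy
  have key : ∀ τ : ℝ, k42 * y2 τ + k43 * y3 τ = k42 * x2 τ + k43 * x3 τ := by
    intro τ
    have h1 : ∀ g : ℝ → ℝ, Continuous g →
        IntervalIntegrable (fun s => g (y1 s)) MeasureTheory.volume 0 τ :=
      fun g hg => (hg.comp hy1c).intervalIntegrable _ _
    rw [hy2, hy3, hx2, hx3,
      intervalIntegral.integral_add (h1 f21 hf21) ((h1 ψ hψ).const_mul _),
      intervalIntegral.integral_sub (h1 f31 hf31) ((h1 ψ hψ).const_mul _),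
      intervalIntegral.integral_const_mul, intervalIntegral.integral_const_mul]
    field_simp
    ring
  funext t
  rw [hy4, hx4]
  simp only [key]
end

section
/- Let n ∈ ℕ and let E : Fin n → Fin n → Prop satisfy: E j i implies j < i (a DAG in topological order). Suppose E j i and every directed path from j to i equals [j, i] (every list p : List (Fin n) of length ≥ 2 with first entry j, last entry i, and List.Chain' E p equals [j, i]). Then for every ℓ with ℓ ≠ j and E ℓ i, there is no directed path from j to ℓ: no list p : List (Fin n) of length ≥ 2 has first entry j, last entry ℓ, and List.Chain' E p. -/
theorem stmt_15 (n : ℕ) (E : Fin n → Fin n → Prop)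
    (hE : ∀ j i, E j i → j < i)
    (j i : Fin n) (hji : E j i)
    (huniq : ∀ p : List (Fin n), 2 ≤ p.length →
      p.head? = some j → p.getLast? = some i → List.Chain' E p → p = [j, i])
    (ℓ : Fin n) (hℓj : ℓ ≠ j) (hℓi : E ℓ i) :
    ¬ ∃ p : List (Fin n), 2 ≤ p.length ∧
      p.head? = some j ∧ p.getLast? = some ℓ ∧ List.Chain' E p := by
  rintro ⟨p, hlen, hhead, hlast, hch⟩
  have hch' : List.IsChain E p := hch
  have h := huniq (p ++ [i]) (by simp; omega) (by simp [hhead]) (by simp)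
    (List.isChain_append.2 ⟨hch', by simp, by
      intro x hx y hy
      simp only [hlast, Option.mem_def, Option.some.injEq, List.head?_cons] at hx hy
      subst hx hy
      exact hℓi⟩)
  have h2 := congrArg List.length h
  simp at h2
  omega
end
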